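/- Let A be a nonconstant polynomial. Then there do not exist entire functions f1, f2 satisfying f1'' + A·f1 = 0 and f2'' + A·f2 = 0, with Wronskian W(f1, f2) = f1·f2' − f1'·f2 identically equal to 1, such that all zeros of f1 and all zeros of f2 are real and each of f1 and f2 has infinitely many positive zeros. -/

import Mathlib

open Complex Filter Set

theorem hasDerivAt_re_of_hasDerivAt {c : ℝ → ℂ} {c' : ℂ} {t : ℝ} (h : HasDerivAt c c' t) :
    HasDerivAt (fun s => (c s).re) c'.re t := by
  exact Complex.reCLM.hasFDerivAt.comp_hasDerivAt t h

theorem hasDerivAt_im_of_hasDerivAt {c : ℝ → ℂ} {c' : ℂ} {t : ℝ} (h : HasDerivAt c c' t) :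
    HasDerivAt (fun s => (c s).im) c'.im t := by
  exact Complex.imCLM.hasFDerivAt.comp_hasDerivAt t h

/-- The derivative of `Re (u * conj v)` along a curve. -/
theorem hasDerivAt_re_mul_conj {u v : ℝ → ℂ} {u' v' : ℂ} {t : ℝ}
    (hu : HasDerivAt u u' t) (hv : HasDerivAt v v' t) :
    HasDerivAt (fun s => (u s).re * (v s).re + (u s).im * (v s).im)
      (u'.re * (v t).re + (u t).re * v'.re + (u'.im * (v t).im + (u t).im * v'.im)) t :=
  ((hasDerivAt_re_of_hasDerivAt hu).mul (hasDerivAt_re_of_hasDerivAt hv)).add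
    ((hasDerivAt_im_of_hasDerivAt hu).mul (hasDerivAt_im_of_hasDerivAt hv))

/-- The derivative of `Im (u * conj v)` along a curve. -/
theorem hasDerivAt_im_mul_conj {u v : ℝ → ℂ} {u' v' : ℂ} {t : ℝ}
    (hu : HasDerivAt u u' t) (hv : HasDerivAt v v' t) :
    HasDerivAt (fun s => (u s).im * (v s).re - (u s).re * (v s).im)
      (u'.im * (v t).re + (u t).im * v'.re - (u'.re * (v t).im + (u t).re * v'.im)) t :=
  ((hasDerivAt_im_of_hasDerivAt hu).mul (hasDerivAt_re_of_hasDerivAt hv)).sub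
    ((hasDerivAt_re_of_hasDerivAt hu).mul (hasDerivAt_im_of_hasDerivAt hv))

/-- A nonzero entire function vanishes on no infinite subset of a bounded real interval. -/
theorem eq_zero_of_infinite_real_zeros {f : ℂ → ℂ} (hf : Differentiable ℂ f) {S : Set ℝ}
    {a b : ℝ} (hS : S.Infinite) (hab : S ⊆ Icc a b) (hz : ∀ x ∈ S, f x = 0) : f = 0 := by
  have hinf : ((fun x : ℝ => (x : ℂ)) '' S).Infinite :=
    hS.image Complex.ofReal_injective.injOn
  obtain ⟨z, -, hacc⟩ := hinf.exists_accPt_of_subset_isCompact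
    (isCompact_Icc.image Complex.continuous_ofReal) (image_mono hab)
  refine AnalyticOnNhd.eq_of_frequently_eq (z₀ := z)
    (fun w _ => hf.analyticAt w) (fun w _ => analyticAt_const) ?_
  rw [accPt_iff_frequently_nhdsNE] at hacc
  refine hacc.mono ?_
  rintro _ ⟨x, hx, rfl⟩
  exact hz x hx

/-- If a real function vanishes at the zeros of `f` and is strictly increasing elsewhere on
a half-line, then `f` has only finitely many positive zeros. -/
theorem false_of_monotone_of_infinite_zeros {f : ℂ → ℂ} (hf : Differentiable ℂ f)
    (hne : f ≠ 0) (hinf : {x : ℝ | 0 < x ∧ f x = 0}.Infinite) {g h : ℝ → ℝ} {X : ℝ}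
    (hg : ∀ x, HasDerivAt g (h x) x) (hg0 : ∀ x : ℝ, f x = 0 → g x = 0)
    (hh : ∀ x, X ≤ x → 0 ≤ h x) (hpos : ∀ x, X ≤ x → h x = 0 → f x = 0) : False := by
  have hS : ({x : ℝ | 0 < x ∧ f x = 0} \ Icc 0 X).Infinite := by
    by_contra hfin
    rw [not_infinite] at hfin
    have h1 : ({x : ℝ | 0 < x ∧ f x = 0} ∩ Icc 0 X).Infinite := by
      intro h2
      exact hinf ((h2.union hfin).subset (by rw [inter_union_sdiff]))
    exact hne (eq_zero_of_infinite_real_zeros hf h1 inter_subset_right fun x hx => hx.1.2)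
  have hX : ∀ x ∈ {x : ℝ | 0 < x ∧ f x = 0} \ Icc 0 X, X ≤ x ∧ f x = 0 := by
    rintro x ⟨⟨hx0, hx⟩, hxX⟩
    refine ⟨?_, hx⟩
    by_contra! hlt
    exact hxX ⟨hx0.le, hlt.le⟩
  obtain ⟨a, ha, b, hb, hab⟩ := hS.nontrivial.exists_lt
  obtain ⟨haX, hfa⟩ := hX a ha
  obtain ⟨-, hfb⟩ := hX b hb
  have hmono : MonotoneOn g (Icc a b) := by
    refine monotoneOn_of_hasDerivWithinAt_nonneg (f' := h) (convex_Icc a b)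
      (fun x _ => (hg x).continuousAt.continuousWithinAt)
      (fun x _ => (hg x).hasDerivWithinAt) fun x hx => ?_
    rw [interior_Icc] at hx
    exact hh x (haX.trans hx.1.le)
  have hzero : ∀ x ∈ Icc a b, g x = 0 := fun x hx =>
    le_antisymm ((hmono hx (right_mem_Icc.2 hab.le) hx.2).trans_eq (hg0 b hfb))
      ((hg0 a hfa).symm.trans_le (hmono (left_mem_Icc.2 hab.le) hx hx.1))
  refine hne (eq_zero_of_infinite_real_zeros hf (Ioo_infinite hab) Ioo_subset_Icc_self ?_)
  intro x hx
  refine hpos x (haX.trans hx.1.le) ?_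
  have hev : g =ᶠ[nhds x] fun _ => 0 := by
    filter_upwards [Ioo_mem_nhds hx.1 hx.2] with y hy using hzero y (Ioo_subset_Icc_self hy)
  exact ((hg x).congr_of_eventuallyEq hev.symm).unique (hasDerivAt_const x 0)

/-- A nonzero real polynomial eventually has the sign of its leading coefficient. -/
theorem eventually_leadingCoeff_mul_eval_pos {P : Polynomial ℝ} (hP : P ≠ 0) :
    ∃ X : ℝ, ∀ x, X ≤ x → 0 < P.leadingCoeff * P.eval x := by
  obtain ⟨φ, hφ, he⟩ := (Polynomial.isEquivalent_atTop_lead P).exists_eq_mul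
  have h1 : ∀ᶠ x in atTop, (1 / 2 : ℝ) < φ x := hφ.eventually (lt_mem_nhds (by norm_num))
  rw [← eventually_atTop]
  filter_upwards [h1, he, eventually_gt_atTop 0] with x hx1 hx2 hx3
  have hl := Polynomial.leadingCoeff_ne_zero.2 hP
  rw [hx2, Pi.mul_apply]
  have : 0 < φ x * (P.leadingCoeff ^ 2 * x ^ P.natDegree) := by positivity
  linarith

theorem exists_eq_map_add_I_mul_map (A : Polynomial ℂ) :
    ∃ P Q : Polynomial ℝ, ∀ z, A.eval z =
      (P.map Complex.ofRealHom).eval z + I * (Q.map Complex.ofRealHom).eval z := by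
  refine ⟨∑ i ∈ Finset.range (A.natDegree + 1), Polynomial.monomial i (A.coeff i).re,
    ∑ i ∈ Finset.range (A.natDegree + 1), Polynomial.monomial i (A.coeff i).im, fun z => ?_⟩
  rw [Polynomial.eval_eq_sum_range]
  simp only [Polynomial.map_sum, Polynomial.map_monomial, Polynomial.eval_finsetSum,
    Polynomial.eval_monomial, Finset.mul_sum, ← Finset.sum_add_distrib]
  refine Finset.sum_congr rfl fun i _ => ?_
  conv_lhs => rw [← Complex.re_add_im (A.coeff i)]
  simp only [Complex.ofRealHom_eq_coe]
  ring

theorem eval_map_ofReal (P : Polynomial ℝ) (x : ℝ) :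
    (P.map Complex.ofRealHom).eval (x : ℂ) = ((P.eval x : ℝ) : ℂ) :=
  Polynomial.eval_map_apply Complex.ofRealHom x

/-- If a nonzero solution of `y'' + A y = 0` has infinitely many positive zeros, then `A` is
real, with positive leading coefficient. -/
theorem exists_real_of_infinite_positive_zeros {A : Polynomial ℂ} {f : ℂ → ℂ}
    (hA : 1 ≤ A.degree)
    (hf : Differentiable ℂ f) (hne : f ≠ 0) (hinf : {x : ℝ | 0 < x ∧ f x = 0}.Infinite)
    (hode : ∀ z, deriv (deriv f) z + A.eval z * f z = 0) :
    ∃ P : Polynomial ℝ, A = P.map Complex.ofRealHom ∧ 0 < P.leadingCoeff := by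
  obtain ⟨P, Q, hPQ⟩ := exists_eq_map_add_I_mul_map A
  have hd : ∀ x : ℝ, HasDerivAt (fun t : ℝ => f t) (deriv f x) x := fun x =>
    (hf x).hasDerivAt.comp_ofReal
  have hdd : ∀ x : ℝ, HasDerivAt (fun t : ℝ => deriv f t)
      (-(((P.eval x : ℝ) : ℂ) + I * ((Q.eval x : ℝ) : ℂ)) * f x) x := fun x => by
    have h2 := (hf.deriv x).hasDerivAt.comp_ofReal
    have h3 := hode x
    rw [hPQ, eval_map_ofReal, eval_map_ofReal] at h3
    convert h2 using 1
    linear_combination -h3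
  have hzero : ∀ x : ℝ, (f x).re ^ 2 + (f x).im ^ 2 = 0 → f x = 0 := fun x hx =>
    Complex.ext (by simp; nlinarith [sq_nonneg (f x).re, sq_nonneg (f x).im])
      (by simp; nlinarith [sq_nonneg (f x).re, sq_nonneg (f x).im])
  have hQ : Q = 0 := by
    by_contra hQ
    obtain ⟨X, hX⟩ := eventually_leadingCoeff_mul_eval_pos hQ
    refine false_of_monotone_of_infinite_zeros hf hne hinf (X := X)
      (g := fun x : ℝ => -Q.leadingCoeff *
        ((deriv f x).im * (f x).re - (deriv f x).re * (f x).im))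
      (h := fun x : ℝ => Q.leadingCoeff * Q.eval x * ((f x).re ^ 2 + (f x).im ^ 2)) ?_ ?_ ?_ ?_
    · intro x
      refine ((hasDerivAt_im_mul_conj (hdd x) (hd x)).const_mul (-Q.leadingCoeff)).congr_deriv ?_
      simp
      ring
    · intro x hx
      simp [hx]
    · intro x hx
      have := hX x hx
      positivity
    · intro x hx h0
      exact hzero x ((mul_eq_zero.1 h0).resolve_left (hX x hx).ne')
  have hAP : A = P.map Complex.ofRealHom := by
    refine Polynomial.funext fun z => ?_
    rw [hPQ, hQ]
    simp
  have hP0 : P ≠ 0 := by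
    rintro rfl
    simp [hAP] at hA
  refine ⟨P, hAP, lt_of_not_ge fun hle => ?_⟩
  obtain ⟨X, hX⟩ := eventually_leadingCoeff_mul_eval_pos hP0
  have hX' : ∀ x, X ≤ x → 0 < -P.eval x := fun x hx => by
    have := hX x hx
    nlinarith
  refine false_of_monotone_of_infinite_zeros hf hne hinf (X := X)
    (g := fun x : ℝ => (deriv f x).re * (f x).re + (deriv f x).im * (f x).im)
    (h := fun x : ℝ => (deriv f x).re ^ 2 + (deriv f x).im ^ 2
      + -P.eval x * ((f x).re ^ 2 + (f x).im ^ 2)) ?_ ?_ ?_ ?_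
  · intro x
    refine (hasDerivAt_re_mul_conj (hdd x) (hd x)).congr_deriv ?_
    simp [hQ]
    ring
  · intro x hx
    simp [hx]
  · intro x hx
    have := hX' x hx
    positivity
  · intro x hx h0
    have h1 := hX' x hx
    have h2 : 0 ≤ -P.eval x * ((f x).re ^ 2 + (f x).im ^ 2) := by positivity
    have h3 : -P.eval x * ((f x).re ^ 2 + (f x).im ^ 2) = 0 := by
      linarith [sq_nonneg (deriv f x).re, sq_nonneg (deriv f x).im]
    exact hzero x ((mul_eq_zero.1 h3).resolve_left h1.ne')

/-- A solution with a real zero has real logarithmic derivative on the real axis. -/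
theorem im_deriv_mul_conj_eq_zero {P : Polynomial ℝ} {f : ℂ → ℂ} (hf : Differentiable ℂ f)
    (hode : ∀ z, deriv (deriv f) z + (P.map Complex.ofRealHom).eval z * f z = 0)
    {x₀ : ℝ} (hx₀ : f x₀ = 0) (x : ℝ) :
    (deriv f x).im * (f x).re - (deriv f x).re * (f x).im = 0 := by
  have hd : ∀ x : ℝ, HasDerivAt
      (fun x : ℝ => (deriv f x).im * (f x).re - (deriv f x).re * (f x).im) 0 x := fun x => by
    have h2 := (hf.deriv x).hasDerivAt.comp_ofReal
    have h3 := hode x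
    rw [eval_map_ofReal] at h3
    rw [eq_neg_of_add_eq_zero_left h3] at h2
    refine (hasDerivAt_im_mul_conj h2 (hf x).hasDerivAt.comp_ofReal).congr_deriv ?_
    simp
    ring
  have := is_const_of_deriv_eq_zero (fun x => (hd x).differentiableAt) (fun x => (hd x).deriv)
    x x₀
  simpa [hx₀] using this

theorem exists_norm_eval_le (p : Polynomial ℂ) {m : ℕ} (hm : p.natDegree ≤ m) :
    ∃ C : ℝ, 0 < C ∧ ∀ z : ℂ, 1 ≤ ‖z‖ → ‖p.eval z‖ ≤ C * ‖z‖ ^ m := by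
  refine ⟨∑ i ∈ Finset.range (p.natDegree + 1), ‖p.coeff i‖ + 1, by positivity, fun z hz => ?_⟩
  have h1 : ‖p.eval z‖ ≤ ∑ i ∈ Finset.range (p.natDegree + 1), ‖p.coeff i‖ * ‖z‖ ^ m := by
    rw [Polynomial.eval_eq_sum_range]
    refine norm_sum_le_of_le _ fun i hi => ?_
    rw [norm_mul, norm_pow]
    have : i ≤ m := by
      rw [Finset.mem_range] at hi
      omega
    gcongr
  rw [← Finset.sum_mul] at h1
  have : 0 ≤ ‖z‖ ^ m := by positivity
  linarith

theorem exists_norm_eval_sub_lead_le (p : Polynomial ℂ) (hp : 1 ≤ p.natDegree) :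
    ∃ C : ℝ, 0 < C ∧ ∀ z : ℂ, 1 ≤ ‖z‖ →
      ‖p.eval z - p.leadingCoeff * z ^ p.natDegree‖ * ‖z‖ ≤ C * ‖z‖ ^ p.natDegree := by
  obtain ⟨C, hC, h⟩ := exists_norm_eval_le p.eraseLead (Polynomial.eraseLead_natDegree_le p)
  refine ⟨C, hC, fun z hz => ?_⟩
  have h1 : p.eval z - p.leadingCoeff * z ^ p.natDegree = p.eraseLead.eval z := by
    rw [sub_eq_iff_eq_add]
    conv_lhs => rw [← Polynomial.eraseLead_add_monomial_natDegree_leadingCoeff p]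
    rw [Polynomial.eval_add, Polynomial.eval_monomial]
  rw [h1]
  calc _ ≤ C * ‖z‖ ^ (p.natDegree - 1) * ‖z‖ := by
        gcongr
        exact h z hz
    _ = C * ‖z‖ ^ p.natDegree := by
        rw [mul_assoc, ← pow_succ, Nat.sub_add_cancel hp]

/-- A local bound for the logarithmic derivative of a zero-free solution of `y'' + A y = 0`. -/
theorem mul_norm_deriv_le_of_zero_free {A f : ℂ → ℂ} (hf : Differentiable ℂ f)
    (hode : ∀ z, deriv (deriv f) z + A z * f z = 0) {z₀ : ℂ} {δ K : ℝ} (hδ : 0 < δ)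
    (hK : ∀ z ∈ Metric.closedBall z₀ δ, ‖A z‖ ≤ K)
    (hz : ∀ z ∈ Metric.closedBall z₀ δ, f z ≠ 0) (hKδ : K * δ ^ 2 ≤ 1 / 4) :
    δ * ‖deriv f z₀‖ ≤ 4 * ‖f z₀‖ := by
  have hK0 : 0 ≤ K := (norm_nonneg _).trans (hK z₀ (Metric.mem_closedBall_self hδ.le))
  obtain ⟨w, hw, hmax⟩ := (isCompact_closedBall z₀ δ).exists_isMaxOn
    ⟨z₀, Metric.mem_closedBall_self hδ.le⟩ hf.continuous.norm.continuousOn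
  set m := ‖f w‖ with hm
  have hmle : ∀ z ∈ Metric.closedBall z₀ δ, ‖f z‖ ≤ m := fun z hz => hmax hz
  have hm0 : 0 ≤ m := norm_nonneg _
  have hdd : ∀ z ∈ Metric.closedBall z₀ δ, ‖deriv (deriv f) z‖ ≤ K * m := fun z hz => by
    rw [eq_neg_of_add_eq_zero_left (hode z), norm_neg, norm_mul]
    exact mul_le_mul (hK z hz) (hmle z hz) (norm_nonneg _) hK0
  have hd : ∀ z ∈ Metric.closedBall z₀ δ, ‖deriv f z - deriv f z₀‖ ≤ K * m * δ := fun z hz => by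
    refine (Convex.norm_image_sub_le_of_norm_deriv_le (fun x _ => hf.deriv x) hdd
      (convex_closedBall z₀ δ) (Metric.mem_closedBall_self hδ.le) hz).trans ?_
    gcongr
    rwa [Metric.mem_closedBall, dist_eq_norm] at hz
  have hdg : ∀ z, HasDerivAt (fun z => f z - deriv f z₀ * (z - z₀)) (deriv f z - deriv f z₀) z :=
    fun z => ((hf z).hasDerivAt.sub
      (((hasDerivAt_id z).sub_const z₀).const_mul (deriv f z₀))).congr_deriv (by simp)
  have herr : ∀ z ∈ Metric.closedBall z₀ δ,
      ‖f z - deriv f z₀ * (z - z₀) - f z₀‖ ≤ m / 4 := fun z hz => by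
    have h1 := Convex.norm_image_sub_le_of_norm_deriv_le
      (f := fun z => f z - deriv f z₀ * (z - z₀)) (C := K * m * δ)
      (fun x _ => (hdg x).differentiableAt) (fun x hx => by rw [(hdg x).deriv]; exact hd x hx)
      (convex_closedBall z₀ δ) (Metric.mem_closedBall_self hδ.le) hz
    rw [Metric.mem_closedBall, dist_eq_norm] at hz
    simp only [sub_self, mul_zero, sub_zero] at h1
    calc _ ≤ K * m * δ * ‖z - z₀‖ := h1
      _ ≤ K * m * δ * δ := by gcongr
      _ = K * δ ^ 2 * m := by ring
      _ ≤ 1 / 4 * m := by gcongr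
      _ = m / 4 := by ring
  have hmub : m ≤ ‖f z₀‖ + ‖deriv f z₀‖ * δ + m / 4 := by
    have h1 := herr w hw
    have h2 : ‖f w‖ ≤ ‖f w - deriv f z₀ * (w - z₀) - f z₀‖ + ‖deriv f z₀ * (w - z₀)‖ + ‖f z₀‖ := by
      refine le_trans (le_of_eq ?_) (norm_add₃_le (a := f w - deriv f z₀ * (w - z₀) - f z₀))
      congr 1
      ring
    have h3 : ‖deriv f z₀ * (w - z₀)‖ ≤ ‖deriv f z₀‖ * δ := by
      rw [norm_mul]
      gcongr
      rwa [Metric.mem_closedBall, dist_eq_norm] at hw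
    linarith
  have hf0 : 0 < ‖f z₀‖ := norm_pos_iff.2 (hz z₀ (Metric.mem_closedBall_self hδ.le))
  by_contra! hlt
  have hsph : ∀ z ∈ Metric.sphere z₀ δ, 4 / 3 * ‖f z₀‖ ≤ ‖f z‖ := fun z hzs => by
    have h1 := herr z (Metric.sphere_subset_closedBall hzs)
    have h2 : ‖deriv f z₀ * (z - z₀)‖ = ‖deriv f z₀‖ * δ := by
      rw [norm_mul]
      rw [mem_sphere_iff_norm] at hzs
      rw [hzs]
    have h3 : ‖deriv f z₀ * (z - z₀)‖ ≤
        ‖f z‖ + ‖f z - deriv f z₀ * (z - z₀) - f z₀‖ + ‖f z₀‖ := by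
      have h4 : deriv f z₀ * (z - z₀) =
        f z + -(f z - deriv f z₀ * (z - z₀) - f z₀) + -f z₀ := by ring
      calc _ = ‖f z + -(f z - deriv f z₀ * (z - z₀) - f z₀) + -f z₀‖ := by rw [← h4]
        _ ≤ _ := norm_add₃_le
        _ = _ := by rw [norm_neg, norm_neg]
    nlinarith
  have hinv := Complex.norm_le_of_forall_mem_frontier_norm_le
    (f := fun z => (f z)⁻¹) (U := Metric.ball z₀ δ) (C := (4 / 3 * ‖f z₀‖)⁻¹)
    Metric.isBounded_ball
    (DifferentiableOn.diffContOnCl fun z hz' => by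
      rw [closure_ball z₀ hδ.ne'] at hz'
      exact ((hf z).inv (hz z hz')).differentiableWithinAt)
    (fun z hz' => by
      rw [frontier_ball z₀ hδ.ne'] at hz'
      rw [norm_inv]
      exact inv_anti₀ (by positivity) (hsph z hz'))
    (subset_closure (Metric.mem_ball_self hδ))
  rw [norm_inv, inv_le_inv₀ hf0 (by positivity)] at hinv
  linarith

/-- In a sector of the upper half-plane the logarithmic derivative of a solution without
zeros there has polynomial growth. -/
theorem exists_norm_logDeriv_le {A : Polynomial ℂ} {f : ℂ → ℂ} (hf : Differentiable ℂ f)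
    (hode : ∀ z, deriv (deriv f) z + A.eval z * f z = 0) (hz : ∀ z, f z = 0 → z.im = 0)
    {η : ℝ} (hη : 0 < η) :
    ∃ C : ℝ, 0 < C ∧ ∀ z : ℂ, 2 ≤ ‖z‖ → η * ‖z‖ ≤ z.im →
      ‖deriv f z / f z‖ ≤ C * ‖z‖ ^ A.natDegree := by
  obtain ⟨K, hK, hA⟩ := exists_norm_eval_le A le_rfl
  set n := A.natDegree
  set K' := K * 2 ^ n with hK'
  have hK'0 : 0 < K' := by positivity
  obtain ⟨c, hc, hc1, hcη, hcK⟩ : ∃ c : ℝ, 0 < c ∧ c ≤ 1 ∧ c ≤ η ∧ K' * c ^ 2 ≤ 1 / 4 := by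
    have hmin : 0 < min 1 (min η (1 / (4 * (K' + 1)))) := by positivity
    refine ⟨_, hmin, min_le_left _ _, (min_le_right _ _).trans (min_le_left _ _), ?_⟩
    have h1 : min 1 (min η (1 / (4 * (K' + 1)))) ≤ 1 := min_le_left _ _
    have h2 : min 1 (min η (1 / (4 * (K' + 1)))) ≤ 1 / (4 * (K' + 1)) :=
      (min_le_right _ _).trans (min_le_right _ _)
    rw [le_div_iff₀ (by positivity)] at h2
    nlinarith
  refine ⟨4 / c, by positivity, fun z hz2 hzη => ?_⟩
  have hz1 : 1 ≤ ‖z‖ ^ n := one_le_pow₀ (by linarith)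
  have hδ : 0 < c / ‖z‖ ^ n := by positivity
  have hδc : c / ‖z‖ ^ n ≤ c := div_le_self hc.le hz1
  have hball : ∀ w ∈ Metric.closedBall z (c / ‖z‖ ^ n), ‖w - z‖ ≤ c := fun w hw => by
    rw [Metric.mem_closedBall, dist_eq_norm] at hw
    exact hw.trans hδc
  have hzf : ∀ w ∈ Metric.closedBall z (c / ‖z‖ ^ n), f w ≠ 0 := fun w hw h0 => by
    have h1 := (Complex.abs_im_le_norm (w - z)).trans (hball w hw)
    rw [Complex.sub_im, hz w h0, zero_sub, abs_neg] at h1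
    nlinarith [le_abs_self z.im]
  have hz0 : 0 < ‖f z‖ := norm_pos_iff.2 (hzf z (Metric.mem_closedBall_self hδ.le))
  have hmain := mul_norm_deriv_le_of_zero_free (A := fun z => A.eval z) (z₀ := z)
    (K := K' * ‖z‖ ^ n) hf hode hδ (fun w hw => by
      have h1 := hball w hw
      have h2 : ‖w‖ ≤ 2 * ‖z‖ := by linarith [norm_le_norm_add_norm_sub' w z]
      have h3 : 1 ≤ ‖w‖ := by linarith [norm_le_norm_add_norm_sub w z]
      calc ‖A.eval w‖ ≤ K * ‖w‖ ^ n := hA w h3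
        _ ≤ K * (2 * ‖z‖) ^ n := by gcongr
        _ = K' * ‖z‖ ^ n := by rw [mul_pow, hK', mul_assoc]) hzf (by
      rw [div_pow]
      have h1 : K' * ‖z‖ ^ n * (c ^ 2 / (‖z‖ ^ n) ^ 2) = K' * c ^ 2 / ‖z‖ ^ n := by
        field_simp
      rw [h1]
      exact (div_le_self (by positivity) hz1).trans hcK)
  rw [norm_div, div_le_iff₀ hz0]
  rw [div_mul_eq_mul_div, div_le_iff₀ (by positivity)] at hmain
  rw [div_mul_eq_mul_div, div_mul_eq_mul_div, le_div_iff₀ hc]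
  linarith

/-- In a sector of the upper half-plane the square of the logarithmic derivative of a solution
without zeros there is asymptotic to `-a zⁿ`. -/
theorem exists_norm_logDeriv_sq_add_le {A : Polynomial ℂ} {f : ℂ → ℂ} (hn : 1 ≤ A.natDegree)
    (hf : Differentiable ℂ f) (hode : ∀ z, deriv (deriv f) z + A.eval z * f z = 0)
    (hz : ∀ z, f z = 0 → z.im = 0) {η : ℝ} (hη : 0 < η) (hη1 : η ≤ 1) :
    ∃ C : ℝ, 0 < C ∧ ∀ z : ℂ, 4 ≤ ‖z‖ → η * ‖z‖ ≤ z.im →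
      ‖(deriv f z / f z) ^ 2 + A.leadingCoeff * z ^ A.natDegree‖ * ‖z‖ ≤
        C * ‖z‖ ^ A.natDegree := by
  obtain ⟨C₁, hC₁, hL⟩ := exists_norm_logDeriv_le hf hode hz (η := η / 4) (by positivity)
  obtain ⟨C₂, hC₂, hA⟩ := exists_norm_eval_sub_lead_le A hn
  set n := A.natDegree
  refine ⟨C₁ * 2 ^ n * (2 / η) + C₂, by positivity, fun z hz4 hzη => ?_⟩
  have hρ : 0 < η / 2 * ‖z‖ := by positivity
  have him : ∀ w ∈ Metric.closedBall z (η / 2 * ‖z‖), η / 2 * ‖z‖ ≤ w.im := fun w hw => by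
    rw [Metric.mem_closedBall, dist_eq_norm] at hw
    have h1 := (abs_le.1 ((Complex.abs_im_le_norm (w - z)).trans hw)).1
    rw [Complex.sub_im] at h1
    linarith
  have hf0 : ∀ w ∈ Metric.closedBall z (η / 2 * ‖z‖), f w ≠ 0 := fun w hw h0 => by
    have := him w hw
    rw [hz w h0] at this
    linarith
  have hbd : ∀ w ∈ Metric.closedBall z (η / 2 * ‖z‖),
      ‖deriv f w / f w‖ ≤ C₁ * 2 ^ n * ‖z‖ ^ n := fun w hw => by
    have h1 := him w hw
    rw [Metric.mem_closedBall, dist_eq_norm] at hw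
    have h0 : η / 2 * ‖z‖ ≤ 1 / 2 * ‖z‖ := by gcongr
    have h2 : ‖w‖ ≤ 2 * ‖z‖ := by linarith [norm_le_norm_add_norm_sub' w z]
    have h3 : 2 ≤ ‖w‖ := by linarith [norm_le_norm_add_norm_sub w z]
    calc _ ≤ C₁ * ‖w‖ ^ n := hL w h3 (by nlinarith)
      _ ≤ C₁ * (2 * ‖z‖) ^ n := by gcongr
      _ = _ := by rw [mul_pow, mul_assoc]
  have hzmem : z ∈ Metric.closedBall z (η / 2 * ‖z‖) := Metric.mem_closedBall_self hρ.le
  have hder : HasDerivAt (fun w => deriv f w / f w)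
      (-(A.eval z + (deriv f z / f z) ^ 2)) z := by
    have h0 := hf0 z hzmem
    refine ((hf.deriv z).hasDerivAt.div (hf z).hasDerivAt h0).congr_deriv ?_
    rw [eq_neg_of_add_eq_zero_left (hode z)]
    field_simp
    ring
  have hcau := Complex.norm_deriv_le_of_forall_mem_sphere_norm_le
    (f := fun w => deriv f w / f w) hρ
    (DifferentiableOn.diffContOnCl fun w hw => by
      rw [closure_ball z hρ.ne'] at hw
      exact ((hf.deriv w).div (hf w) (hf0 w hw)).differentiableWithinAt)
    (fun w hw => hbd w (Metric.sphere_subset_closedBall hw))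
  rw [hder.deriv, norm_neg, le_div_iff₀ hρ] at hcau
  have h1 : ‖A.eval z + (deriv f z / f z) ^ 2‖ * ‖z‖ ≤ C₁ * 2 ^ n * (2 / η) * ‖z‖ ^ n := by
    calc _ = ‖A.eval z + (deriv f z / f z) ^ 2‖ * (η / 2 * ‖z‖) * (2 / η) := by field_simp
      _ ≤ C₁ * 2 ^ n * ‖z‖ ^ n * (2 / η) := by gcongr
      _ = _ := by ring
  have h2 := hA z (by linarith)
  have h3 : (deriv f z / f z) ^ 2 + A.leadingCoeff * z ^ n =
      (A.eval z + (deriv f z / f z) ^ 2) - (A.eval z - A.leadingCoeff * z ^ n) := by ring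
  rw [h3]
  calc _ ≤ (‖A.eval z + (deriv f z / f z) ^ 2‖ + ‖A.eval z - A.leadingCoeff * z ^ n‖) * ‖z‖ := by
        gcongr
        exact norm_sub_le _ _
    _ ≤ _ := by linarith

/-- A solution which is real on the real axis has logarithmic derivative with nonpositive
argument just above the positive real axis. -/
theorem exists_im_mul_deriv_mul_conj_nonpos {A : Polynomial ℂ} {f : ℂ → ℂ} {a : ℝ} (ha : 0 < a)
    (hA : A.leadingCoeff = a) (hn : 1 ≤ A.natDegree)
    (hf : Differentiable ℂ f) (hode : ∀ z, deriv (deriv f) z + A.eval z * f z = 0)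
    (hreal : ∀ x : ℝ, (deriv f x).im * (f x).re - (deriv f x).re * (f x).im = 0)
    {θ : ℝ} (hθ : 0 ≤ θ) (hθn : (A.natDegree + 2) * θ ≤ Real.pi / 3) :
    ∃ R : ℝ, ∀ r, R ≤ r →
      (circleMap 0 r θ * deriv f (circleMap 0 r θ)).im * (f (circleMap 0 r θ)).re -
        (circleMap 0 r θ * deriv f (circleMap 0 r θ)).re * (f (circleMap 0 r θ)).im ≤ 0 := by
  obtain ⟨C, hC, hAC⟩ := exists_norm_eval_sub_lead_le A hn
  set n := A.natDegree
  refine ⟨max 1 (2 * (C + 1) / a), fun r hr => ?_⟩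
  have hr1 : 1 ≤ r := (le_max_left _ _).trans hr
  have hra : 2 * (C + 1) ≤ r * a := by
    rw [← div_le_iff₀ ha]
    exact (le_max_right _ _).trans hr
  have hnorm : ∀ t, ‖circleMap 0 r t‖ = r := fun t => by
    rw [norm_circleMap_zero, abs_of_pos (by linarith)]
  have hAre : ∀ t ∈ Icc 0 θ, 1 / 4 ≤ (circleMap 0 r t ^ 2 * A.eval (circleMap 0 r t)).re := by
    intro t ht
    set z := circleMap 0 r t with hz
    have h1 := hAC z (by rw [hnorm]; exact hr1)
    rw [hnorm, hA] at h1
    have h2 : z ^ 2 * A.eval z = a * z ^ (n + 2) + z ^ 2 * (A.eval z - a * z ^ n) := by ring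
    have h3 : ‖z ^ 2 * (A.eval z - a * z ^ n)‖ ≤ C * r ^ (n + 1) := by
      rw [norm_mul, norm_pow, hnorm]
      calc _ = r * (‖A.eval z - a * z ^ n‖ * r) := by ring
        _ ≤ r * (C * r ^ n) := by gcongr
        _ = _ := by ring
    have h4 : ((a : ℂ) * z ^ (n + 2)).re = a * (r ^ (n + 2) * Real.cos ((n + 2) * t)) := by
      have : (a : ℂ) * z ^ (n + 2) =
          ((a * r ^ (n + 2) : ℝ) : ℂ) * exp (((n + 2) * t : ℝ) * I) := by
        rw [hz, circleMap, zero_add, mul_pow, ← Complex.exp_nat_mul]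
        push_cast
        ring_nf
      rw [this, Complex.re_ofReal_mul, Complex.exp_ofReal_mul_I_re, mul_assoc]
    have h5 : 1 / 2 ≤ Real.cos ((n + 2) * t) := by
      rw [← Real.cos_pi_div_three]
      refine Real.cos_le_cos_of_nonneg_of_le_pi (mul_nonneg (by positivity) ht.1)
        (by linarith [Real.pi_pos]) (le_trans ?_ hθn)
      gcongr
      exact ht.2
    have h6 := (abs_le.1 ((Complex.abs_re_le_norm _).trans h3)).1
    have h7 : a * (r ^ (n + 2) * (1 / 2)) ≤ a * (r ^ (n + 2) * Real.cos ((n + 2) * t)) := by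
      gcongr
    have h8 : 1 ≤ r ^ (n + 1) := one_le_pow₀ hr1
    rw [h2, Complex.add_re, h4]
    have h9 : r ^ (n + 2) = r ^ (n + 1) * r := pow_succ _ _
    rw [h9] at h7 ⊢
    nlinarith
  have hV : ∀ t, HasDerivAt (fun t =>
      (circleMap 0 r t * deriv f (circleMap 0 r t)).im * (f (circleMap 0 r t)).re -
        (circleMap 0 r t * deriv f (circleMap 0 r t)).re * (f (circleMap 0 r t)).im)
      ((circleMap 0 r t * deriv f (circleMap 0 r t)).re * (f (circleMap 0 r t)).re +
        (circleMap 0 r t * deriv f (circleMap 0 r t)).im * (f (circleMap 0 r t)).im -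
        (circleMap 0 r t ^ 2 * A.eval (circleMap 0 r t)).re *
          ((f (circleMap 0 r t)).re ^ 2 + (f (circleMap 0 r t)).im ^ 2) -
        ((circleMap 0 r t * deriv f (circleMap 0 r t)).re ^ 2 +
          (circleMap 0 r t * deriv f (circleMap 0 r t)).im ^ 2)) t := by
    intro t
    have hc := hasDerivAt_circleMap 0 r t
    set z := circleMap 0 r t with hz
    have hv : HasDerivAt (fun t => f (circleMap 0 r t)) (I * (z * deriv f z)) t :=
      ((hf z).hasDerivAt.comp t hc).congr_deriv (by ring)
    have hf' : HasDerivAt (fun t => deriv f (circleMap 0 r t)) (deriv (deriv f) z * (z * I)) t :=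
      HasDerivAt.comp (h₂ := deriv f) t (hf.deriv z).hasDerivAt hc
    have hu : HasDerivAt (fun t => circleMap 0 r t * deriv f (circleMap 0 r t))
        (I * (z * deriv f z - z ^ 2 * A.eval z * f z)) t :=
      (hc.fun_mul hf').congr_deriv (by
        rw [← hz]
        rw [eq_neg_of_add_eq_zero_left (hode z)]
        ring)
    refine (hasDerivAt_im_mul_conj hu hv).congr_deriv ?_
    rw [← hz]
    generalize z * deriv f z = u
    generalize z ^ 2 * A.eval z = w
    simp
    ring
  have hanti : AntitoneOn (fun t =>
      (circleMap 0 r t * deriv f (circleMap 0 r t)).im * (f (circleMap 0 r t)).re -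
        (circleMap 0 r t * deriv f (circleMap 0 r t)).re * (f (circleMap 0 r t)).im)
      (Icc 0 θ) := by
    refine antitoneOn_of_hasDerivWithinAt_nonpos (convex_Icc 0 θ)
      (fun t _ => (hV t).continuousAt.continuousWithinAt)
      (fun t _ => (hV t).hasDerivWithinAt) fun t ht => ?_
    have h1 := hAre t (interior_subset ht)
    generalize circleMap 0 r t * deriv f (circleMap 0 r t) = u at *
    generalize (circleMap 0 r t ^ 2 * A.eval (circleMap 0 r t)).re = w at *
    generalize f (circleMap 0 r t) = v at *
    have h2 : 0 ≤ (w - 1 / 4) * (v.re ^ 2 + v.im ^ 2) := by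
      have : 0 ≤ w - 1 / 4 := by linarith
      positivity
    nlinarith [sq_nonneg (u.re - v.re / 2), sq_nonneg (u.im - v.im / 2)]
  refine (hanti (left_mem_Icc.2 hθ) (right_mem_Icc.2 hθ) hθ).trans_eq ?_
  have h0 : circleMap 0 r 0 = r := by simp [circleMap]
  simp only [h0, Complex.re_ofReal_mul, Complex.im_ofReal_mul]
  linear_combination r * hreal r

/-- A continuous function with values near `{1, -1}` stays near `-1` if it starts there. -/
theorem norm_add_one_le_of_continuousOn {q : ℝ → ℂ} {s t ε : ℝ} (hst : s ≤ t)
    (hq : ContinuousOn q (Icc s t)) (hε : ε < 1) (hqε : ∀ x ∈ Icc s t, ‖q x ^ 2 - 1‖ ≤ ε)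
    (hs : (q s).re ≤ 0) : ‖q t + 1‖ ≤ ε := by
  have hre : ∀ x ∈ Icc s t, (q x).re ≠ 0 := fun x hx h0 => by
    have h1 := (abs_le.1 ((Complex.abs_re_le_norm _).trans (hqε x hx))).1
    simp [pow_two, h0] at h1
    nlinarith [mul_self_nonneg (q x).im]
  have hneg : (q t).re ≤ 0 := by
    by_contra! hpos
    obtain ⟨x, hx, hx0⟩ := intermediate_value_Icc hst
      (Complex.continuous_re.comp_continuousOn hq) ⟨hs, hpos.le⟩
    exact hre x hx hx0
  have h1 : 1 ≤ ‖q t - 1‖ := by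
    have h2 := Complex.abs_re_le_norm (q t - 1)
    rw [Complex.sub_re, Complex.one_re] at h2
    exact le_trans (by rw [abs_of_nonpos] <;> linarith) h2
  have h2 := hqε t (right_mem_Icc.2 hst)
  have h3 : q t ^ 2 - 1 = (q t - 1) * (q t + 1) := by ring
  rw [h3, norm_mul] at h2
  nlinarith [norm_nonneg (q t + 1)]

theorem exists_mul_le_sin {s t : ℝ} (hs : 0 < s) (ht : t < Real.pi) :
    ∃ η : ℝ, 0 < η ∧ η ≤ 1 ∧ ∀ x ∈ Icc s t, η ≤ Real.sin x := by
  rcases (Icc s t).eq_empty_or_nonempty with he | hne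
  · exact ⟨1, one_pos, le_rfl, by simp [he]⟩
  · obtain ⟨x, hx, hmin⟩ := isCompact_Icc.exists_isMinOn hne Real.continuous_sin.continuousOn
    exact ⟨Real.sin x, Real.sin_pos_of_pos_of_lt_pi (hs.trans_le hx.1) (hx.2.trans_lt ht),
      Real.sin_le_one x, fun y hy => hmin hy⟩

/-- A solution with only real zeros which is real on the real axis decays along a ray in the
upper half-plane. -/
theorem exists_re_mul_logDeriv_le {A : Polynomial ℂ} {f : ℂ → ℂ} {a : ℝ} (ha : 0 < a)
    (hA : A.leadingCoeff = a) (hn : 1 ≤ A.natDegree)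
    (hf : Differentiable ℂ f) (hode : ∀ z, deriv (deriv f) z + A.eval z * f z = 0)
    (hz : ∀ z, f z = 0 → z.im = 0)
    (hreal : ∀ x : ℝ, (deriv f x).im * (f x).re - (deriv f x).re * (f x).im = 0) (M : ℝ) :
    ∃ R : ℝ, ∀ r, R ≤ r →
      (circleMap 0 r (7 * Real.pi / (3 * (A.natDegree + 2))) *
        (deriv f (circleMap 0 r (7 * Real.pi / (3 * (A.natDegree + 2)))) /
          f (circleMap 0 r (7 * Real.pi / (3 * (A.natDegree + 2)))))).re ≤ -M := by
  set n := A.natDegree with hndef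
  set s : ℝ := Real.pi / (3 * (n + 2)) with hs
  set t : ℝ := 7 * Real.pi / (3 * (n + 2)) with ht
  have hn' : (1 : ℝ) ≤ n := by exact_mod_cast hn
  have hpi := Real.pi_pos
  have hs0 : 0 < s := by positivity
  have hst : s ≤ t := by
    rw [hs, ht]
    gcongr
    linarith
  have htpi : t < Real.pi := by
    rw [ht, div_lt_iff₀ (by positivity)]
    nlinarith
  have hsn : (n + 2) * s = Real.pi / 3 := by
    rw [hs]
    field_simp
  have htn : (n + 2) * t = 7 * Real.pi / 3 := by
    rw [ht]
    field_simp
  obtain ⟨η, hη, hη1, hsin⟩ := exists_mul_le_sin hs0 htpi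
  obtain ⟨C, hC, hL⟩ := exists_norm_logDeriv_sq_add_le hn hf hode hz hη hη1
  obtain ⟨R₀, hR₀⟩ := exists_im_mul_deriv_mul_conj_nonpos ha hA hn hf hode hreal hs0.le hsn.le
  refine ⟨max (max 4 R₀) (max (4 * C / a) ((4 * M) ^ 2 / a)), fun r hr => ?_⟩
  have hr4 : 4 ≤ r := (le_max_left _ _).trans ((le_max_left _ _).trans hr)
  have hrR : R₀ ≤ r := (le_max_right _ _).trans ((le_max_left _ _).trans hr)
  have hrC : 4 * C ≤ r * a := by
    rw [← div_le_iff₀ ha]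
    exact (le_max_left _ _).trans ((le_max_right _ _).trans hr)
  have hrM : (4 * M) ^ 2 ≤ r * a := by
    rw [← div_le_iff₀ ha]
    exact (le_max_right _ _).trans ((le_max_right _ _).trans hr)
  have hr0 : 0 < r := by linarith
  have hnorm : ∀ x, ‖circleMap 0 r x‖ = r := fun x => by
    rw [norm_circleMap_zero, abs_of_pos hr0]
  have him : ∀ x, (circleMap 0 r x).im = r * Real.sin x := fun x => by
    rw [circleMap, zero_add, Complex.im_ofReal_mul, Complex.exp_ofReal_mul_I_im]
  have him' : ∀ x ∈ Icc s t, η * ‖circleMap 0 r x‖ ≤ (circleMap 0 r x).im := fun x hx => by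
    rw [hnorm, him, mul_comm]
    gcongr
    exact hsin x hx
  have hf0 : ∀ x ∈ Icc s t, f (circleMap 0 r x) ≠ 0 := fun x hx h0 => by
    have h1 := him' x hx
    rw [hnorm, hz _ h0] at h1
    nlinarith
  set T : ℝ → ℂ := fun x =>
    circleMap 0 r x * (deriv f (circleMap 0 r x) / f (circleMap 0 r x)) with hT
  set σ : ℝ := √(a * r ^ (n + 2)) with hσ
  have hσ0 : 0 < σ := Real.sqrt_pos.2 (by positivity)
  have hσ2 : σ ^ 2 = a * r ^ (n + 2) := Real.sq_sqrt (by positivity)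
  set E : ℝ → ℂ := fun x => exp (((n + 2) * x / 2 : ℝ) * I) with hE
  have hE0 : ∀ x, E x ≠ 0 := fun x => Complex.exp_ne_zero _
  have hE2 : ∀ x, ((σ : ℂ) * E x) ^ 2 = a * circleMap 0 r x ^ (n + 2) := fun x => by
    rw [mul_pow, ← Complex.ofReal_pow, hσ2, hE, circleMap, zero_add, mul_pow,
      ← Complex.exp_nat_mul, ← Complex.exp_nat_mul]
    push_cast
    ring_nf
  have hσ0' : (σ : ℂ) ≠ 0 := Complex.ofReal_ne_zero.2 hσ0.ne'
  set q : ℝ → ℂ := fun x => T x / (I * (σ * E x)) with hq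
  have hTq : ∀ x, T x = I * (σ * (E x * q x)) := fun x => by
    simp only [hq]
    have := hE0 x
    field_simp
  have hqc : ContinuousOn q (Icc s t) := by
    have hcm : Continuous (circleMap 0 r) := continuous_circleMap 0 r
    have hEc : Continuous E := by fun_prop
    refine ContinuousOn.div (hcm.continuousOn.mul
      (((hf.deriv.continuous.comp hcm).continuousOn).div (hf.continuous.comp hcm).continuousOn hf0))
      (by fun_prop) fun x _ => ?_
    exact mul_ne_zero I_ne_zero (mul_ne_zero hσ0' (hE0 x))
  have hqε : ∀ x ∈ Icc s t, ‖q x ^ 2 - 1‖ ≤ 1 / 4 := fun x hx => by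
    have h1 := hL (circleMap 0 r x) (by rw [hnorm]; exact hr4) (him' x hx)
    have h2 : -((σ : ℂ) * E x) ^ 2 * (q x ^ 2 - 1) = circleMap 0 r x ^ 2 *
        ((deriv f (circleMap 0 r x) / f (circleMap 0 r x)) ^ 2
          + A.leadingCoeff * circleMap 0 r x ^ n) := by
      have h3 : T x ^ 2 = -((σ : ℂ) * E x) ^ 2 * q x ^ 2 := by
        rw [hTq]
        ring_nf
        rw [I_sq]
        ring
      rw [mul_sub, ← h3, hE2, hA]
      simp only [hT]
      ring
    have h3 := congrArg norm h2
    rw [norm_mul, norm_neg, hE2, norm_mul, norm_pow, hnorm, Complex.norm_real, norm_mul, norm_pow,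
      hnorm, Real.norm_of_nonneg ha.le] at h3
    rw [hnorm] at h1
    have h4 : a * r ^ (n + 2) * ‖q x ^ 2 - 1‖ ≤ a * r ^ (n + 2) * (1 / 4) := by
      rw [h3]
      calc _ = r * (‖(deriv f (circleMap 0 r x) / f (circleMap 0 r x)) ^ 2
            + A.leadingCoeff * circleMap 0 r x ^ n‖ * r) := by ring
        _ ≤ r * (C * r ^ n) := by gcongr
        _ = r ^ (n + 1) * C := by ring
        _ ≤ r ^ (n + 1) * (r * a / 4) := by
          gcongr
          linarith
        _ = _ := by ring
    exact le_of_mul_le_mul_left h4 (by positivity)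
  have hEs : E s = exp ((Real.pi / 6 : ℝ) * I) := by
    simp only [hE, hsn]
    congr 3
    ring
  have hEt : E t = -exp ((Real.pi / 6 : ℝ) * I) := by
    simp only [hE, htn]
    rw [← Complex.exp_add_pi_mul_I]
    congr 1
    push_cast
    ring
  have hre : (exp ((Real.pi / 6 : ℝ) * I)).re = √3 / 2 := by
    rw [Complex.exp_ofReal_mul_I_re, Real.cos_pi_div_six]
  have him6 : (exp ((Real.pi / 6 : ℝ) * I)).im = 1 / 2 := by
    rw [Complex.exp_ofReal_mul_I_im, Real.sin_pi_div_six]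
  have hsqrt : (3 : ℝ) / 2 ≤ √3 := by
    rw [Real.le_sqrt' (by norm_num)]
    norm_num
  have hexp : ‖exp ((Real.pi / 6 : ℝ) * I)‖ = 1 := Complex.norm_exp_ofReal_mul_I _
  have hTs : (T s).im ≤ 0 := by
    have h1 := hR₀ r hrR
    have h2 := hf0 s (left_mem_Icc.2 hst)
    have h3 : circleMap 0 r s * deriv f (circleMap 0 r s) = T s * f (circleMap 0 r s) := by
      simp only [hT]
      field_simp
    rw [h3] at h1
    have h4 : 0 < normSq (f (circleMap 0 r s)) := Complex.normSq_pos.2 h2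
    rw [Complex.normSq_apply] at h4
    simp only [Complex.mul_re, Complex.mul_im] at h1
    nlinarith
  have hqs : (q s).re ≤ 0 := by
    by_contra! hpos
    have h1 := norm_add_one_le_of_continuousOn (q := fun x => -q x) (s := s) (t := s)
      (ε := 1 / 4) le_rfl
      ((hqc.mono (Icc_subset_Icc_right hst)).neg) (by norm_num)
      (fun x hx => by simpa using hqε x (Icc_subset_Icc_right hst hx)) (by simpa using hpos.le)
    have h2 : (T s).im = σ * (√3 / 2 -
        (exp ((Real.pi / 6 : ℝ) * I) * (-q s + 1)).re) := by
      rw [hTq, hEs]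
      simp only [Complex.mul_im, Complex.mul_re, Complex.I_re, Complex.I_im, Complex.ofReal_re,
        Complex.ofReal_im, Complex.add_re, Complex.add_im, Complex.neg_re, Complex.neg_im,
        Complex.one_re, Complex.one_im, hre, him6]
      ring
    have h3 : (exp ((Real.pi / 6 : ℝ) * I) * (-q s + 1)).re ≤ 1 / 4 := by
      refine (Complex.re_le_norm _).trans ?_
      rw [norm_mul, hexp, one_mul]
      exact h1
    nlinarith
  have hqt := norm_add_one_le_of_continuousOn hst hqc (by norm_num) hqε hqs
  change (T t).re ≤ -M
  have h2 : (T t).re = σ * (-(1 / 2) + (exp ((Real.pi / 6 : ℝ) * I) * (q t + 1)).im) := by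
    rw [hTq, hEt]
    simp only [Complex.mul_im, Complex.mul_re, Complex.I_re, Complex.I_im, Complex.ofReal_re,
      Complex.ofReal_im, Complex.add_re, Complex.add_im, Complex.neg_re, Complex.neg_im,
      Complex.one_re, Complex.one_im, hre, him6]
    ring
  have h3 : (exp ((Real.pi / 6 : ℝ) * I) * (q t + 1)).im ≤ 1 / 4 := by
    refine (Complex.im_le_norm _).trans ?_
    rw [norm_mul, hexp, one_mul]
    exact hqt
  have h4 : 4 * M ≤ σ := by
    refine Real.le_sqrt_of_sq_le (hrM.trans ?_)
    have : r ≤ r ^ (n + 2) := le_self_pow₀ (by linarith) (by omega)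
    nlinarith
  nlinarith

theorem stmt4 (A : Polynomial ℂ) (hA : 1 ≤ A.degree) :
    ¬ ∃ f₁ f₂ : ℂ → ℂ,
      Differentiable ℂ f₁ ∧ Differentiable ℂ f₂ ∧
      (∀ z : ℂ, deriv (deriv f₁) z + A.eval z * f₁ z = 0) ∧
      (∀ z : ℂ, deriv (deriv f₂) z + A.eval z * f₂ z = 0) ∧
      (∀ z : ℂ, f₁ z * deriv f₂ z - deriv f₁ z * f₂ z = 1) ∧
      (∀ z : ℂ, f₁ z = 0 → z.im = 0) ∧ (∀ z : ℂ, f₂ z = 0 → z.im = 0) ∧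
      {x : ℝ | 0 < x ∧ f₁ (x : ℂ) = 0}.Infinite ∧
      {x : ℝ | 0 < x ∧ f₂ (x : ℂ) = 0}.Infinite := by
  rintro ⟨f₁, f₂, hf₁, hf₂, hode₁, hode₂, hW, hz₁, hz₂, hinf₁, hinf₂⟩
  have hne₁ : f₁ ≠ 0 := by
    rintro rfl
    simpa using hW 0
  obtain ⟨P, rfl, ha⟩ := exists_real_of_infinite_positive_zeros hA hf₁ hne₁ hinf₁ hode₁
  obtain ⟨x₁, -, hx₁⟩ := hinf₁.nonempty
  obtain ⟨x₂, -, hx₂⟩ := hinf₂.nonempty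
  have hr₁ := im_deriv_mul_conj_eq_zero hf₁ hode₁ hx₁
  have hr₂ := im_deriv_mul_conj_eq_zero hf₂ hode₂ hx₂
  have hlead : (P.map Complex.ofRealHom).leadingCoeff = ((P.leadingCoeff : ℝ) : ℂ) :=
    Polynomial.leadingCoeff_map _
  generalize P.map Complex.ofRealHom = A at *
  have hn : 1 ≤ A.natDegree := Polynomial.le_natDegree_of_coe_le_degree hA
  set n := A.natDegree with hndef
  obtain ⟨R₁, hR₁⟩ := exists_re_mul_logDeriv_le ha hlead hn hf₁ hode₁ hz₁ hr₁ (n + 1)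
  obtain ⟨R₂, hR₂⟩ := exists_re_mul_logDeriv_le ha hlead hn hf₂ hode₂ hz₂ hr₂ (n + 1)
  rw [← hndef] at hR₁ hR₂
  set θ : ℝ := 7 * Real.pi / (3 * (n + 2)) with hθ
  have hn' : (1 : ℝ) ≤ n := by exact_mod_cast hn
  have hsin : 0 < Real.sin θ := by
    refine Real.sin_pos_of_pos_of_lt_pi (by positivity) ?_
    rw [hθ, div_lt_iff₀ (by positivity)]
    nlinarith [Real.pi_pos]
  obtain ⟨C₁, hC₁, hL₁⟩ := exists_norm_logDeriv_le hf₁ hode₁ hz₁ hsin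
  obtain ⟨C₂, hC₂, hL₂⟩ := exists_norm_logDeriv_le hf₂ hode₂ hz₂ hsin
  set R := max 2 (max R₁ R₂) with hR
  have hR2 : 2 ≤ R := le_max_left _ _
  have him : ∀ r, (circleMap 0 r θ).im = r * Real.sin θ := fun r => by
    rw [circleMap, zero_add, Complex.im_ofReal_mul, Complex.exp_ofReal_mul_I_im]
  have hne : ∀ r, R ≤ r → f₁ (circleMap 0 r θ) ≠ 0 ∧ f₂ (circleMap 0 r θ) ≠ 0 := fun r hr => by
    have h1 : 0 < (circleMap 0 r θ).im := by
      rw [him]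
      have : 0 < r := by linarith
      positivity
    exact ⟨fun h => h1.ne' (hz₁ _ h), fun h => h1.ne' (hz₂ _ h)⟩
  -- `‖G‖ ^ 2` is the squared modulus of `zⁿ⁺¹ f₁ f₂` along the ray
  set G : ℂ → ℂ := fun z => z ^ (n + 1) * (f₁ z * f₂ z) with hG
  have hGd : ∀ r, R ≤ r → HasDerivAt (fun r : ℝ => ‖G (circleMap 0 r θ)‖ ^ 2)
      (2 * ‖G (circleMap 0 r θ)‖ ^ 2 / r * ((n + 1) +
        (circleMap 0 r θ * (deriv f₁ (circleMap 0 r θ) / f₁ (circleMap 0 r θ))).re +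
        (circleMap 0 r θ * (deriv f₂ (circleMap 0 r θ) / f₂ (circleMap 0 r θ))).re)) r := by
    intro r hr
    obtain ⟨h1, h2⟩ := hne r hr
    have hr0 : (r : ℂ) ≠ 0 := Complex.ofReal_ne_zero.2 (by linarith)
    have hc : HasDerivAt (fun r : ℝ => circleMap 0 r θ) (exp (θ * I)) r := by
      simpa [circleMap] using (hasDerivAt_id r).ofReal_comp.mul_const (exp (θ * I))
    have hz : circleMap 0 r θ = r * exp (θ * I) := by rw [circleMap, zero_add]
    have hG' : HasDerivAt G ((n + 1) * circleMap 0 r θ ^ n *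
        (f₁ (circleMap 0 r θ) * f₂ (circleMap 0 r θ)) + circleMap 0 r θ ^ (n + 1) *
        (deriv f₁ (circleMap 0 r θ) * f₂ (circleMap 0 r θ) +
          f₁ (circleMap 0 r θ) * deriv f₂ (circleMap 0 r θ))) (circleMap 0 r θ) := by
      simpa using (hasDerivAt_pow (n + 1) (circleMap 0 r θ)).fun_mul
        ((hf₁ _).hasDerivAt.fun_mul (hf₂ _).hasDerivAt)
    have hcomp : HasDerivAt (fun r : ℝ => G (circleMap 0 r θ)) (G (circleMap 0 r θ) *
        ((r⁻¹ : ℝ) * (((n + 1 : ℝ) : ℂ) +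
          circleMap 0 r θ * (deriv f₁ (circleMap 0 r θ) / f₁ (circleMap 0 r θ)) +
          circleMap 0 r θ * (deriv f₂ (circleMap 0 r θ) / f₂ (circleMap 0 r θ))))) r := by
      refine (hG'.comp r hc).congr_deriv ?_
      have he : exp (θ * I) = (r : ℂ)⁻¹ * circleMap 0 r θ := by
        rw [hz]
        field_simp
      rw [he]
      simp only [hG]
      generalize circleMap 0 r θ = z at *
      push_cast
      field_simp
      ring
    refine hcomp.norm_sq.congr_deriv ?_
    rw [Complex.inner, mul_right_comm, Complex.mul_conj, Complex.re_ofReal_mul,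
      Complex.re_ofReal_mul, Complex.add_re, Complex.add_re, Complex.ofReal_re,
      Complex.normSq_eq_norm_sq]
    ring
  have hanti : AntitoneOn (fun r : ℝ => ‖G (circleMap 0 r θ)‖ ^ 2) (Ici R) := by
    refine antitoneOn_of_hasDerivWithinAt_nonpos (convex_Ici R)
      (fun r hr => (hGd r hr).continuousAt.continuousWithinAt)
      (fun r hr => (hGd r (interior_subset hr)).hasDerivWithinAt) fun r hr => ?_
    have hrR : R ≤ r := interior_subset hr
    have h1 := hR₁ r (((le_max_left _ _).trans (le_max_right _ _)).trans hrR)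
    have h2 := hR₂ r (((le_max_right _ _).trans (le_max_right _ _)).trans hrR)
    have h3 : 0 < r := by linarith
    exact mul_nonpos_of_nonneg_of_nonpos (by positivity) (by linarith)
  have hlow : ∀ r, R ≤ r → r ≤ (C₁ + C₂) * ‖G (circleMap 0 r θ)‖ := fun r hr => by
    obtain ⟨h1, h2⟩ := hne r hr
    have hr0 : 0 < r := by linarith
    have hnorm : ‖circleMap 0 r θ‖ = r := by rw [norm_circleMap_zero, abs_of_pos hr0]
    have hb₁ := hL₁ (circleMap 0 r θ) (by rw [hnorm]; linarith) (by rw [hnorm, him, mul_comm])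
    have hb₂ := hL₂ (circleMap 0 r θ) (by rw [hnorm]; linarith) (by rw [hnorm, him, mul_comm])
    have hW' := hW (circleMap 0 r θ)
    rw [hnorm, ← hndef] at hb₁ hb₂
    have hGn : ‖G (circleMap 0 r θ)‖ =
        r ^ (n + 1) * ‖f₁ (circleMap 0 r θ) * f₂ (circleMap 0 r θ)‖ := by
      rw [hG, norm_mul, norm_pow, hnorm]
    rw [hGn]
    generalize circleMap 0 r θ = z at *
    have h3 : f₁ z * f₂ z * (deriv f₂ z / f₂ z - deriv f₁ z / f₁ z) = 1 := by
      rw [← hW']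
      field_simp
    have h4 := congrArg norm h3
    rw [norm_mul, norm_one] at h4
    have h5 : ‖deriv f₂ z / f₂ z - deriv f₁ z / f₁ z‖ ≤ (C₁ + C₂) * r ^ n :=
      (norm_sub_le _ _).trans (by linarith)
    calc r = r * (‖f₁ z * f₂ z‖ * ‖deriv f₂ z / f₂ z - deriv f₁ z / f₁ z‖) := by rw [h4, mul_one]
      _ ≤ r * (‖f₁ z * f₂ z‖ * ((C₁ + C₂) * r ^ n)) := by gcongr
      _ = _ := by ring
  set B := ‖G (circleMap 0 R θ)‖ with hB
  have hB0 : 0 ≤ B := norm_nonneg _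
  have hr := hlow (R + (C₁ + C₂) * B) (by
    have : 0 ≤ (C₁ + C₂) * B := by positivity
    linarith)
  have hle : ‖G (circleMap 0 (R + (C₁ + C₂) * B) θ)‖ ≤ B := by
    have h1 : 0 ≤ (C₁ + C₂) * B := by positivity
    have h2 := hanti (mem_Ici.2 le_rfl) (mem_Ici.2 (by linarith : R ≤ R + (C₁ + C₂) * B))
      (by linarith)
    exact (sq_le_sq₀ (norm_nonneg _) hB0).1 h2
  have : (C₁ + C₂) * ‖G (circleMap 0 (R + (C₁ + C₂) * B) θ)‖ ≤ (C₁ + C₂) * B := by gcongr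
  linarith
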